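/- Let β > 1 be a real number, let N ≥ 2 be an integer, let l, m ≥ 1 be integers, and let d₁ ∈ {1,…,N−1}, d₂ ∈ {0,…,N−1}. Then 1 − (d₁−d₂)(β^m−1)/(d₁·β^{l+m}) > 0 and |log(1 − (d₁−d₂)(β^m−1)/(d₁·β^{l+m}))| ≤ max{ −log(1 − β^{−1}), log(1 + (N−2)·β^{−1}) }. -/

import Mathlib

/-- If `0 < a ≤ x ≤ b`, then `|log x|` is at most the larger of `-log a` and `log b`. -/
theorem abs_log_le_max_neg_log_log {a b x : ℝ} (ha : 0 < a) (hax : a ≤ x) (hxb : x ≤ b) :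
    |Real.log x| ≤ max (-Real.log a) (Real.log b) := by
  have hx := ha.trans_le hax
  exact abs_le'.2 ⟨le_max_of_le_right (Real.log_le_log hx hxb),
    le_max_of_le_left (neg_le_neg (Real.log_le_log ha hax))⟩

theorem pow_sub_one_div_pow_add_le_inv {β : ℝ} (hβ : 1 ≤ β) {l : ℕ} (hl : 1 ≤ l) (m : ℕ) :
    (β ^ m - 1) / β ^ (l + m) ≤ β⁻¹ := by
  have hβ0 : 0 < β := by linarith
  rw [div_le_iff₀ (by positivity), ← div_eq_inv_mul, le_div_iff₀ hβ0]
  calc (β ^ m - 1) * β ≤ β ^ m * β := by gcongr; linarith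
    _ = β ^ (m + 1) := (pow_succ β m).symm
    _ ≤ β ^ (l + m) := pow_le_pow_right₀ hβ (by omega)

theorem stmt18
    (β : ℝ) (hβ : 1 < β) (N : ℤ) (hN : 2 ≤ N) (l m : ℕ) (hl : 1 ≤ l) (hm : 1 ≤ m)
    (d₁ d₂ : ℤ) (hd₁ : 1 ≤ d₁) (hd₁u : d₁ ≤ N - 1) (hd₂ : 0 ≤ d₂) (hd₂u : d₂ ≤ N - 1) :
    0 < 1 - ((d₁ : ℝ) - (d₂ : ℝ)) * (β ^ m - 1) / ((d₁ : ℝ) * β ^ (l + m)) ∧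
    |Real.log (1 - ((d₁ : ℝ) - (d₂ : ℝ)) * (β ^ m - 1) / ((d₁ : ℝ) * β ^ (l + m)))| ≤
      max (-Real.log (1 - β⁻¹)) (Real.log (1 + ((N : ℝ) - 2) * β⁻¹)) := by
  have hβ0 : 0 < β := by linarith
  have hN' : (2 : ℝ) ≤ N := by exact_mod_cast hN
  have hd₁' : (1 : ℝ) ≤ d₁ := by exact_mod_cast hd₁
  have hd₂' : (0 : ℝ) ≤ d₂ := by exact_mod_cast hd₂
  have hd₂u' : (d₂ : ℝ) ≤ N - 1 := by exact_mod_cast hd₂u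
  have hd₁0 : (0 : ℝ) < d₁ := by linarith
  rw [mul_div_mul_comm]
  set t := (β ^ m - 1) / β ^ (l + m)
  set a := ((d₁ : ℝ) - d₂) / d₁
  have ht0 : 0 ≤ t := div_nonneg (sub_nonneg.2 (one_le_pow₀ hβ.le)) (by positivity)
  have ht : t ≤ β⁻¹ := pow_sub_one_div_pow_add_le_inv hβ.le hl m
  have ha1 : a ≤ 1 := (div_le_one hd₁0).2 (by linarith)
  have ha : -((N : ℝ) - 2) ≤ a := (le_div_iff₀ hd₁0).2 (by nlinarith)
  have hpos : 0 < 1 - β⁻¹ := sub_pos.2 (inv_lt_one_of_one_lt₀ hβ)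
  have hlower : 1 - β⁻¹ ≤ 1 - a * t := by nlinarith
  have hupper : 1 - a * t ≤ 1 + ((N : ℝ) - 2) * β⁻¹ := by nlinarith
  exact ⟨hpos.trans_le hlower, abs_log_le_max_neg_log_log hpos hlower hupper⟩
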